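/- arXiv:2209.03478 — 2 statements merged into one kernel-verified Lean document; each statement's English description precedes it below -/
import Mathlib

section
/- For every Q₁=(q₁,q₂,q₃), Q₂=(q₅,q₆,q₇) ∈ {0,1}³, every x⃗=(x₁,x₂,x₃) ∈ {0,1}³ of even Hamming weight, every sign s ∈ {+1,−1}, and all bits a,b,c ∈ {0,1} with a+b+c even, the 7-qubit vector v_{x⃗,s} satisfies (I ⊗ I ⊗ I ⊗ X ⊗ P_a ⊗ P_b ⊗ P_c) v_{x⃗,s} = s · (−1)^{x₁} · (√−1)^{a+b+c} · (−1)^{a q₅ + b q₆ + c q₇} · v_{x⃗,s}. (The sign (−1)^{x₁} reproduces exactly the four cases x⃗ = (0,0,0), (1,0,1), (0,1,1), (1,1,0) listed in the paper, with signs +, −, +, − respectively.) -/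
open Matrix Complex

noncomputable section

/-- Single-qubit Pauli X. -/
def Xg : Matrix (Fin 2) (Fin 2) ℂ := !![0, 1; 1, 0]
/-- Single-qubit Pauli Y. -/
def Yg : Matrix (Fin 2) (Fin 2) ℂ := !![0, -Complex.I; Complex.I, 0]
/-- Single-qubit Pauli Z. -/
def Zg : Matrix (Fin 2) (Fin 2) ℂ := !![1, 0; 0, -1]
/-- P₀ = X, P₁ = Y. -/
def Pg : Fin 2 → Matrix (Fin 2) (Fin 2) ℂ := fun i => if i = 0 then Xg else Yg

/-- Tensor (Kronecker) product of `n` single-qubit operators, as a matrix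
indexed by bit strings. -/
def tens {n : ℕ} (M : Fin n → Matrix (Fin 2) (Fin 2) ℂ) :
    Matrix (Fin n → Fin 2) (Fin n → Fin 2) ℂ :=
  Matrix.of fun r c => ∏ m, M m (r m) (c m)

/-- Computational basis vector |q⟩. -/
def ket {n : ℕ} (q : Fin n → Fin 2) : (Fin n → Fin 2) → ℂ :=
  fun r => if r = q then 1 else 0

/-- The eigenvector v_{x⃗,s} of the paper (7 qubits). -/
def vx (q₁ q₂ q₃ q₅ q₆ q₇ x₁ x₂ x₃ : Fin 2) (s : ℂ) : (Fin 7 → Fin 2) → ℂ :=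
  (ket ![q₁, q₂, q₃, 0, q₅, q₆, q₇]
    + ((-1 : ℂ) ^ (x₁ : ℕ)) • ket ![q₁, q₂, q₃, 0, q₅+1, q₆+1, q₇+1]
    + ((-1 : ℂ) ^ (x₂ : ℕ)) • ket ![q₁+1, q₂+1, q₃+1, 0, q₅, q₆, q₇]
    + ((-1 : ℂ) ^ (x₃ : ℕ)) • ket ![q₁+1, q₂+1, q₃+1, 0, q₅+1, q₆+1, q₇+1])
  + s • (ket ![q₁, q₂, q₃, 1, q₅, q₆, q₇]
    + ((-1 : ℂ) ^ (x₁ : ℕ)) • ket ![q₁, q₂, q₃, 1, q₅+1, q₆+1, q₇+1]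
    + ((-1 : ℂ) ^ (x₂ : ℕ)) • ket ![q₁+1, q₂+1, q₃+1, 1, q₅, q₆, q₇]
    + ((-1 : ℂ) ^ (x₃ : ℕ)) • ket ![q₁+1, q₂+1, q₃+1, 1, q₅+1, q₆+1, q₇+1])

/-- If every tensor factor sends `|q m⟩` to `α m • |q' m⟩`, the tensor product sends `|q⟩` to
`(∏ m, α m) • |q'⟩`. -/
theorem tens_mulVec_ket {n : ℕ} (M : Fin n → Matrix (Fin 2) (Fin 2) ℂ) (q q' : Fin n → Fin 2)
    (α : Fin n → ℂ) (h : ∀ m r, M m r (q m) = if r = q' m then α m else 0) :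
    (tens M).mulVec (ket q) = (∏ m, α m) • ket q' := by
  ext r
  simp only [Matrix.mulVec, dotProduct, tens, ket, Matrix.of_apply, mul_ite, mul_one, mul_zero,
    Finset.sum_ite_eq', Finset.mem_univ, if_true, Pi.smul_apply, smul_eq_mul, h]
  split_ifs with hr
  · simp [hr]
  · obtain ⟨m, hm⟩ := Function.ne_iff.mp hr
    exact Finset.prod_eq_zero (Finset.mem_univ m) (if_neg hm)

theorem one_apply_bit (q r : Fin 2) :
    (1 : Matrix (Fin 2) (Fin 2) ℂ) r q = if r = q then 1 else 0 :=
  Matrix.one_apply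

theorem Xg_apply_bit (q r : Fin 2) : Xg r q = if r = q + 1 then 1 else 0 := by
  fin_cases q <;> fin_cases r <;> simp [Xg]

theorem Pg_apply_bit (a q r : Fin 2) :
    Pg a r q = if r = q + 1 then I ^ (a : ℕ) * (-1) ^ ((a : ℕ) * (q : ℕ)) else 0 := by
  fin_cases a <;> fin_cases q <;> fin_cases r <;> simp [Pg, Xg, Yg]

theorem tens_pauli_mulVec_ket (q₁ q₂ q₃ t q₅ q₆ q₇ a b c : Fin 2) :
    (tens ![1, 1, 1, Xg, Pg a, Pg b, Pg c]).mulVec (ket ![q₁, q₂, q₃, t, q₅, q₆, q₇]) =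
      (I ^ ((a : ℕ) + (b : ℕ) + (c : ℕ)) *
        (-1 : ℂ) ^ ((a : ℕ) * (q₅ : ℕ) + (b : ℕ) * (q₆ : ℕ) + (c : ℕ) * (q₇ : ℕ))) •
        ket ![q₁, q₂, q₃, t + 1, q₅ + 1, q₆ + 1, q₇ + 1] := by
  rw [tens_mulVec_ket _ _ ![q₁, q₂, q₃, t + 1, q₅ + 1, q₆ + 1, q₇ + 1]
    ![1, 1, 1, 1, I ^ (a : ℕ) * (-1) ^ ((a : ℕ) * (q₅ : ℕ)),
      I ^ (b : ℕ) * (-1) ^ ((b : ℕ) * (q₆ : ℕ)), I ^ (c : ℕ) * (-1) ^ ((c : ℕ) * (q₇ : ℕ))]]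
  · congr 1
    simp only [Fin.prod_univ_succ, Fin.prod_univ_zero, Matrix.cons_val_zero, Matrix.cons_val_succ]
    ring
  · intro m r
    fin_cases m
    · exact one_apply_bit q₁ r
    · exact one_apply_bit q₂ r
    · exact one_apply_bit q₃ r
    · exact Xg_apply_bit t r
    · exact Pg_apply_bit a q₅ r
    · exact Pg_apply_bit b q₆ r
    · exact Pg_apply_bit c q₇ r

theorem bit_add_one_add_one (q : Fin 2) : q + 1 + 1 = q := by
  fin_cases q <;> rfl

theorem neg_one_pow_mul_bit_add_one (a q : Fin 2) :
    (-1 : ℂ) ^ ((a : ℕ) * ((q + 1 : Fin 2) : ℕ)) =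
      (-1) ^ (a : ℕ) * (-1) ^ ((a : ℕ) * (q : ℕ)) := by
  fin_cases a <;> fin_cases q <;> simp

theorem neg_one_pow_complement (a b c q₅ q₆ q₇ : Fin 2)
    (heven : Even ((a : ℕ) + (b : ℕ) + (c : ℕ))) :
    (-1 : ℂ) ^ ((a : ℕ) * ((q₅ + 1 : Fin 2) : ℕ) + (b : ℕ) * ((q₆ + 1 : Fin 2) : ℕ) +
        (c : ℕ) * ((q₇ + 1 : Fin 2) : ℕ)) =
      (-1) ^ ((a : ℕ) * (q₅ : ℕ) + (b : ℕ) * (q₆ : ℕ) + (c : ℕ) * (q₇ : ℕ)) := by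
  have h := heven.neg_one_pow (α := ℂ)
  simp only [pow_add, neg_one_pow_mul_bit_add_one] at h ⊢
  linear_combination ((-1 : ℂ) ^ ((a : ℕ) * (q₅ : ℕ)) * (-1) ^ ((b : ℕ) * (q₆ : ℕ)) *
    (-1) ^ ((c : ℕ) * (q₇ : ℕ))) * h

theorem stmt6 (q₁ q₂ q₃ q₅ q₆ q₇ x₁ x₂ x₃ : Fin 2)
    (hx : Even ((x₁ : ℕ) + (x₂ : ℕ) + (x₃ : ℕ)))
    (s : ℂ) (hs : s = 1 ∨ s = -1)
    (a b c : Fin 2) (heven : Even ((a : ℕ) + (b : ℕ) + (c : ℕ))) :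
    (tens ![1, 1, 1, Xg, Pg a, Pg b, Pg c]).mulVec
      (vx q₁ q₂ q₃ q₅ q₆ q₇ x₁ x₂ x₃ s) =
      (s * (-1 : ℂ) ^ (x₁ : ℕ) * Complex.I ^ ((a : ℕ) + (b : ℕ) + (c : ℕ)) *
        (-1 : ℂ) ^ ((a : ℕ) * (q₅ : ℕ) + (b : ℕ) * (q₆ : ℕ) + (c : ℕ) * (q₇ : ℕ))) •
        vx q₁ q₂ q₃ q₅ q₆ q₇ x₁ x₂ x₃ s := by
  have hs2 : s * s = 1 := by rcases hs with rfl | rfl <;> norm_num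
  have sq (x : Fin 2) : (-1 : ℂ) ^ (x : ℕ) * (-1) ^ (x : ℕ) = 1 := by
    rw [← mul_pow]; norm_num
  have h12 : (-1 : ℂ) ^ (x₁ : ℕ) * (-1) ^ (x₂ : ℕ) = (-1) ^ (x₃ : ℕ) := by
    have h := hx.neg_one_pow (α := ℂ)
    rw [pow_add, pow_add] at h
    linear_combination (-1 : ℂ) ^ (x₃ : ℕ) * h - (-1) ^ (x₁ : ℕ) * (-1) ^ (x₂ : ℕ) * sq x₃
  simp only [vx, Matrix.mulVec_add, Matrix.mulVec_smul, tens_pauli_mulVec_ket,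
    neg_one_pow_complement a b c q₅ q₆ q₇ heven, bit_add_one_add_one, zero_add,
    show (1 : Fin 2) + 1 = 0 from rfl]
  generalize I ^ ((a : ℕ) + (b : ℕ) + (c : ℕ)) = ω
  generalize (-1 : ℂ) ^ ((a : ℕ) * (q₅ : ℕ) + (b : ℕ) * (q₆ : ℕ) + (c : ℕ) * (q₇ : ℕ)) = ε
  rw [← h12]
  have h1 := sq x₁
  generalize (-1 : ℂ) ^ (x₁ : ℕ) = e₁ at *
  generalize (-1 : ℂ) ^ (x₂ : ℕ) = e₂ at *
  match_scalars <;> grind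
end
end

section
/- For all bits i,j,k ∈ {0,1} with i+j+k odd, the 5-qubit unitary W_{3y} satisfies the conjugation identity (√−1)^{i+j+k+1} · W_{3y} (I ⊗ Z ⊗ Z^j ⊗ Z^k ⊗ Z) W_{3y}† = I ⊗ P_i ⊗ P_j ⊗ P_k ⊗ Y. -/
open Matrix Complex

noncomputable section

/-- Single-qubit Hadamard gate. -/
def Hg : Matrix (Fin 2) (Fin 2) ℂ := (Real.sqrt 2)⁻¹ • !![1, 1; 1, -1]

/-- CNOT with control `c` and target `t`, acting on `n` qubits. -/
def CNOTg {n : ℕ} (c t : Fin n) : Matrix (Fin n → Fin 2) (Fin n → Fin 2) ℂ :=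
  Matrix.of fun r col => if r = Function.update col t (col t + col c) then 1 else 0

/-- W_{3y} = CNOT_{(2;1,3,4)} · H_{(2)} · Z_{(2)} · CNOT_{(2;1,5)} · H_{(2)} · CNOT_{(2,1)}. -/
def W3y : Matrix (Fin 5 → Fin 2) (Fin 5 → Fin 2) ℂ :=
  (CNOTg 1 0 * CNOTg 1 2 * CNOTg 1 3) * tens ![1, Hg, 1, 1, 1] * tens ![1, Zg, 1, 1, 1] *
    (CNOTg 1 0 * CNOTg 1 4) * tens ![1, Hg, 1, 1, 1] * CNOTg 1 0

theorem tens_mul {n : ℕ} (M N : Fin n → Matrix (Fin 2) (Fin 2) ℂ) :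
    tens M * tens N = tens fun m => M m * N m := by
  ext r c
  simp only [tens, mul_apply, of_apply, ← Finset.prod_mul_distrib]
  exact (Fintype.prod_sum fun m s => M m (r m) s * N m s (c m)).symm

theorem tens_smul {n : ℕ} (z : Fin n → ℂ) (M : Fin n → Matrix (Fin 2) (Fin 2) ℂ) :
    (tens fun m => z m • M m) = (∏ m, z m) • tens M := by
  ext r c
  simp [tens, Finset.prod_mul_distrib]

theorem tens_one {n : ℕ} : tens (fun _ : Fin n => 1) = 1 := by
  ext r c
  simp [tens, one_apply, Finset.prod_ite_zero, funext_iff]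

theorem tens_conjTranspose {n : ℕ} (M : Fin n → Matrix (Fin 2) (Fin 2) ℂ) :
    (tens M)ᴴ = tens fun m => (M m)ᴴ := by
  ext r c
  simp [tens, conjTranspose_apply]

theorem semiconjBy_tens {n : ℕ} {U M N : Fin n → Matrix (Fin 2) (Fin 2) ℂ}
    (h : ∀ m, SemiconjBy (U m) (M m) (N m)) : SemiconjBy (tens U) (tens M) (tens N) := by
  simp only [SemiconjBy, tens_mul, fun m => (h m).eq]

theorem tens_mul_conjTranspose {n : ℕ} {U : Fin n → Matrix (Fin 2) (Fin 2) ℂ}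
    (h : ∀ m, U m * (U m)ᴴ = 1) : tens U * (tens U)ᴴ = 1 := by
  simp only [tens_conjTranspose, tens_mul, h, tens_one]

/-- The action of CNOT on bit strings. -/
def cnotMap {n : ℕ} (c t : Fin n) (v : Fin n → Fin 2) : Fin n → Fin 2 :=
  Function.update v t (v t + v c)

theorem fin_two_add_self (x : Fin 2) : x + x = 0 := by decide +revert

theorem cnotMap_cnotMap {n : ℕ} {c t : Fin n} (h : c ≠ t) (v : Fin n → Fin 2) :
    cnotMap c t (cnotMap c t v) = v := by
  simp [cnotMap, h, add_assoc, fin_two_add_self]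

theorem cnotMap_add {n : ℕ} (c t : Fin n) (v w : Fin n → Fin 2) :
    cnotMap c t (v + w) = cnotMap c t v + cnotMap c t w := by
  ext m : 1
  by_cases hm : m = t
  · subst hm; simp [cnotMap, add_add_add_comm]
  · simp [cnotMap, hm]

theorem eq_cnotMap_iff {n : ℕ} {c t : Fin n} (h : c ≠ t) (v w : Fin n → Fin 2) :
    v = cnotMap c t w ↔ w = cnotMap c t v :=
  ⟨fun e => by rw [e, cnotMap_cnotMap h], fun e => by rw [e, cnotMap_cnotMap h]⟩

theorem CNOTg_apply {n : ℕ} (c t : Fin n) (r s : Fin n → Fin 2) :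
    CNOTg c t r s = if r = cnotMap c t s then 1 else 0 := rfl

theorem CNOTg_mul_apply {n : ℕ} {c t : Fin n} (h : c ≠ t)
    (A : Matrix (Fin n → Fin 2) (Fin n → Fin 2) ℂ) (r s : Fin n → Fin 2) :
    (CNOTg c t * A) r s = A (cnotMap c t r) s := by
  simp [mul_apply, CNOTg_apply, eq_cnotMap_iff h r]

theorem mul_CNOTg_apply {n : ℕ} (c t : Fin n)
    (A : Matrix (Fin n → Fin 2) (Fin n → Fin 2) ℂ) (r s : Fin n → Fin 2) :
    (A * CNOTg c t) r s = A r (cnotMap c t s) := by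
  simp [mul_apply, CNOTg_apply]

theorem CNOTg_mul_conjTranspose {n : ℕ} {c t : Fin n} (h : c ≠ t) :
    CNOTg c t * (CNOTg c t)ᴴ = 1 := by
  ext r s
  simp [CNOTg_mul_apply h, conjTranspose_apply, CNOTg_apply, one_apply, cnotMap_cnotMap h,
    eq_comm (a := s), apply_ite star]

/-- The Pauli operator `⨂ₘ X ^ aₘ Z ^ bₘ`. -/
def pauliString {n : ℕ} (a b : Fin n → Fin 2) : Matrix (Fin n → Fin 2) (Fin n → Fin 2) ℂ :=
  tens fun m => Xg ^ (a m : ℕ) * Zg ^ (b m : ℕ)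

theorem X_pow_mul_Z_pow_apply (a b r s : Fin 2) :
    (Xg ^ (a : ℕ) * Zg ^ (b : ℕ)) r s = if r = s + a then (-1) ^ ((b * s : Fin 2) : ℕ) else 0 := by
  fin_cases a <;> fin_cases b <;> fin_cases r <;> fin_cases s <;>
    simp [Xg, Zg, mul_apply]

theorem pauliString_apply {n : ℕ} (a b r s : Fin n → Fin 2) :
    pauliString a b r s =
      if r = s + a then ∏ m, (-1 : ℂ) ^ ((b m * s m : Fin 2) : ℕ) else 0 := by
  simp [pauliString, tens, X_pow_mul_Z_pow_apply, Finset.prod_ite_zero, funext_iff]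

theorem neg_one_pow_fin_two_add (x y : Fin 2) :
    (-1 : ℂ) ^ ((x + y : Fin 2) : ℕ) = (-1) ^ (x : ℕ) * (-1) ^ (y : ℕ) := by
  fin_cases x <;> fin_cases y <;> simp

theorem prod_cnotMap_sign {n : ℕ} {c t : Fin n} (h : c ≠ t) (b s : Fin n → Fin 2) :
    ∏ m, (-1 : ℂ) ^ ((cnotMap t c b m * cnotMap c t s m : Fin 2) : ℕ) =
      ∏ m, (-1 : ℂ) ^ ((b m * s m : Fin 2) : ℕ) := by
  have ht : t ∈ Finset.univ.erase c := by simp [h.symm]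
  rw [← Finset.mul_prod_erase _ _ (Finset.mem_univ c), ← Finset.mul_prod_erase _ _ ht,
    ← Finset.mul_prod_erase Finset.univ (fun m => (-1 : ℂ) ^ ((b m * s m : Fin 2) : ℕ))
      (Finset.mem_univ c), ← Finset.mul_prod_erase _ _ ht, ← mul_assoc, ← mul_assoc]
  congr 1
  · simp only [cnotMap, Function.update_self, Function.update_of_ne h, Function.update_of_ne h.symm,
      ← neg_one_pow_fin_two_add]
    congr 2
    generalize b c = x, b t = y, s c = z, s t = w
    decide +revert
  · refine Finset.prod_congr rfl fun m hm => ?_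
    simp only [Finset.mem_erase] at hm
    simp [cnotMap, hm.1, hm.2.1]

theorem semiconjBy_CNOTg_pauliString {n : ℕ} {c t : Fin n} (h : c ≠ t) (a b : Fin n → Fin 2) :
    SemiconjBy (CNOTg c t) (pauliString a b) (pauliString (cnotMap c t a) (cnotMap t c b)) := by
  ext r s
  rw [CNOTg_mul_apply h, mul_CNOTg_apply, pauliString_apply, pauliString_apply,
    prod_cnotMap_sign h, ← cnotMap_add]
  simp only [eq_cnotMap_iff h r, eq_comm]

theorem semiconjBy_H_X_Z : SemiconjBy Hg Xg Zg := by
  ext r s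
  fin_cases r <;> fin_cases s <;> simp [Hg, Xg, Zg, mul_apply]

theorem semiconjBy_H_Z_X : SemiconjBy Hg Zg Xg := by
  ext r s
  fin_cases r <;> fin_cases s <;> simp [Hg, Xg, Zg, mul_apply]

theorem H_mul_conjTranspose : Hg * Hgᴴ = 1 := by
  have h : ((√2 : ℝ) : ℂ)⁻¹ * ((√2 : ℝ) : ℂ)⁻¹ = 2⁻¹ := by
    rw [← mul_inv, ← Complex.ofReal_mul, Real.mul_self_sqrt zero_le_two, Complex.ofReal_ofNat]
  ext r s
  fin_cases r <;> fin_cases s <;> simp [Hg, mul_apply, h] <;> norm_num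

theorem Z_mul_conjTranspose : Zg * Zgᴴ = 1 := by
  ext r s
  fin_cases r <;> fin_cases s <;> simp [Zg, mul_apply]

theorem P_eq_smul (i : Fin 2) : Pg i = Complex.I ^ (i : ℕ) • (Xg * Zg ^ (i : ℕ)) := by
  ext r s
  fin_cases i <;> fin_cases r <;> fin_cases s <;> simp [Pg, Xg, Yg, Zg]

theorem mul_conjTranspose_mul_eq_one {m : Type*} [Fintype m] [DecidableEq m] {U V : Matrix m m ℂ}
    (hU : U * Uᴴ = 1) (hV : V * Vᴴ = 1) : (U * V) * (U * V)ᴴ = 1 := by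
  rw [conjTranspose_mul, Matrix.mul_assoc, ← Matrix.mul_assoc V, hV, Matrix.one_mul, hU]

theorem tens_single_mul_conjTranspose {U : Matrix (Fin 2) (Fin 2) ℂ} (h : U * Uᴴ = 1) :
    tens ![1, U, 1, 1, 1] * (tens ![1, U, 1, 1, 1])ᴴ = 1 :=
  tens_mul_conjTranspose fun m => by fin_cases m <;> simp [h]

theorem semiconjBy_tens_single {U M N : Matrix (Fin 2) (Fin 2) ℂ} (h : SemiconjBy U M N)
    (A B C D : Matrix (Fin 2) (Fin 2) ℂ) :
    SemiconjBy (tens ![1, U, 1, 1, 1]) (tens ![A, M, B, C, D]) (tens ![A, N, B, C, D]) :=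
  semiconjBy_tens fun m => by fin_cases m <;> simp [h]

theorem W3y_mul_conjTranspose : W3y * W3yᴴ = 1 := by
  have hH := tens_single_mul_conjTranspose H_mul_conjTranspose
  have hZ := tens_single_mul_conjTranspose Z_mul_conjTranspose
  have hC {t : Fin 5} (h : 1 ≠ t) := CNOTg_mul_conjTranspose h
  have h₀ := hC (t := 0) (by decide)
  have h₂ := hC (t := 2) (by decide)
  have h₃ := hC (t := 3) (by decide)
  have h₄ := hC (t := 4) (by decide)
  have mul {U V : Matrix (Fin 5 → Fin 2) (Fin 5 → Fin 2) ℂ} (hU : U * Uᴴ = 1) (hV : V * Vᴴ = 1) :=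
    mul_conjTranspose_mul_eq_one hU hV
  exact mul (mul (mul (mul (mul (mul (mul h₀ h₂) h₃) hH) hZ) (mul h₀ h₄)) hH) h₀

theorem pauliString_five (a b : Fin 5 → Fin 2) :
    pauliString a b = tens ![Xg ^ (a 0 : ℕ) * Zg ^ (b 0 : ℕ), Xg ^ (a 1 : ℕ) * Zg ^ (b 1 : ℕ),
      Xg ^ (a 2 : ℕ) * Zg ^ (b 2 : ℕ), Xg ^ (a 3 : ℕ) * Zg ^ (b 3 : ℕ),
      Xg ^ (a 4 : ℕ) * Zg ^ (b 4 : ℕ)] := by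
  unfold pauliString
  congr 1
  ext m : 1
  fin_cases m <;> rfl

theorem semiconjBy_CNOTg_pauliString_of_eq {n : ℕ} {c t : Fin n} (h : c ≠ t)
    {a b a' b' : Fin n → Fin 2} (ha : cnotMap c t a = a') (hb : cnotMap t c b = b') :
    SemiconjBy (CNOTg c t) (pauliString a b) (pauliString a' b') :=
  ha ▸ hb ▸ semiconjBy_CNOTg_pauliString h a b

theorem semiconjBy_W3y (j k : Fin 2) :
    SemiconjBy W3y (pauliString ![0, 0, 0, 0, 0] ![0, 1, j, k, 1])
      (pauliString ![0, 1, 1, 1, 1] ![0, 1 + k + j, j, k, 1]) := by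
  have s₁ : SemiconjBy (CNOTg 1 0) (pauliString ![0, 0, 0, 0, 0] ![0, 1, j, k, 1])
      (pauliString ![0, 0, 0, 0, 0] ![0, 1, j, k, 1]) :=
    semiconjBy_CNOTg_pauliString_of_eq (by decide) (by decide) (by decide +revert)
  have s₂ : SemiconjBy (tens ![1, Hg, 1, 1, 1]) (pauliString ![0, 0, 0, 0, 0] ![0, 1, j, k, 1])
      (pauliString ![0, 1, 0, 0, 0] ![0, 0, j, k, 1]) := by
    rw [pauliString_five, pauliString_five]
    exact semiconjBy_tens_single (by simpa using semiconjBy_H_Z_X) _ _ _ _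
  have s₃ : SemiconjBy (CNOTg 1 0 * CNOTg 1 4) (pauliString ![0, 1, 0, 0, 0] ![0, 0, j, k, 1])
      (pauliString ![1, 1, 0, 0, 1] ![0, 1, j, k, 1]) :=
    .mul_left
      (semiconjBy_CNOTg_pauliString_of_eq (by decide) (by decide)
        (by clear * -; decide +revert))
      (semiconjBy_CNOTg_pauliString (by decide) _ _)
  have s₄ : SemiconjBy (tens ![1, Hg, 1, 1, 1] * tens ![1, Zg, 1, 1, 1])
      (pauliString ![1, 1, 0, 0, 1] ![0, 1, j, k, 1])
      (pauliString ![1, 1, 0, 0, 1] ![0, 1, j, k, 1]) := by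
    rw [pauliString_five]
    refine .mul_left (semiconjBy_tens_single ?_ _ _ _ _)
      (semiconjBy_tens_single (N := Zg * Xg) ?_ _ _ _ _)
    · simpa using semiconjBy_H_Z_X.mul_right semiconjBy_H_X_Z
    · simp [SemiconjBy, mul_assoc]
  have s₅ : SemiconjBy (CNOTg 1 0 * CNOTg 1 2 * CNOTg 1 3)
      (pauliString ![1, 1, 0, 0, 1] ![0, 1, j, k, 1])
      (pauliString ![0, 1, 1, 1, 1] ![0, 1 + k + j, j, k, 1]) :=
    .mul_left (.mul_left
      (semiconjBy_CNOTg_pauliString_of_eq (by decide) (by decide)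
        (by clear * -; decide +revert))
      (semiconjBy_CNOTg_pauliString (by decide) _ _))
      (semiconjBy_CNOTg_pauliString (by decide) _ _)
  have s := (((s₅.mul_left s₄).mul_left s₃).mul_left s₂).mul_left s₁
  simpa only [W3y, Matrix.mul_assoc] using s

theorem bit_eq_of_odd (i j k : Fin 2) (h : Odd ((i : ℕ) + (j : ℕ) + (k : ℕ))) :
    1 + k + j = i := by
  decide +revert

theorem stmt16 (i j k : Fin 2) (hodd : Odd ((i : ℕ) + (j : ℕ) + (k : ℕ))) :
    Complex.I ^ ((i : ℕ) + (j : ℕ) + (k : ℕ) + 1) •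
      (W3y * tens ![1, Zg, Zg ^ (j : ℕ), Zg ^ (k : ℕ), Zg] * W3yᴴ) =
    tens ![1, Pg i, Pg j, Pg k, Yg] := by
  have hs : tens ![1, Zg, Zg ^ (j : ℕ), Zg ^ (k : ℕ), Zg] =
      pauliString ![0, 0, 0, 0, 0] ![0, 1, j, k, 1] := by
    simp [pauliString_five]
  have hY : Yg = Complex.I • (Xg * Zg) := by simpa [Pg] using P_eq_smul 1
  rw [hs, (semiconjBy_W3y j k).eq, Matrix.mul_assoc, W3y_mul_conjTranspose, Matrix.mul_one,
    bit_eq_of_odd i j k hodd]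
  have hz : Complex.I ^ ((i : ℕ) + (j : ℕ) + (k : ℕ) + 1) = ∏ m, ![1, Complex.I ^ (i : ℕ),
      Complex.I ^ (j : ℕ), Complex.I ^ (k : ℕ), Complex.I] m := by
    simp [Fin.prod_univ_five, pow_add]
  rw [hz, pauliString, ← tens_smul]
  congr 1
  ext m : 1
  fin_cases m <;> simp [P_eq_smul, hY]
end
end
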